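/- Suppose η(s) = Σ_{x∈Γ} e^{−s d(o,x)} (a Dirichlet series with nonnegative exponents d(o,x) ≥ 0) has abscissa of convergence v > 0 and admits an extension analytic on Re(s) ≥ v except for a simple pole with positive residue at s = v. Then the counting function N(T) = #{x ∈ Γ : d(o,x) < T} satisfies N(T) ∼ C e^{vT} as T → ∞ for some constant C > 0. -/

import Mathlib

open MeasureTheory Filter Set Topology

noncomputable def Kr (y : ℝ) : ℝ := 2 * (1 - Real.cos y) / y ^ 2

lemma Kr_nonneg (y : ℝ) : 0 ≤ Kr y := by
  unfold Kr
  have := Real.cos_le_one y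
  apply div_nonneg <;> nlinarith [sq_nonneg y]

lemma Kr_meas : Measurable Kr := by
  unfold Kr; fun_prop

lemma Kr_le_one (y : ℝ) : Kr y ≤ 1 := by
  unfold Kr
  have := Real.one_sub_sq_div_two_le_cos (x := y)
  apply div_le_one_of_le₀ <;> nlinarith [sq_nonneg y]

lemma Kr_le (y : ℝ) : Kr y ≤ 5 * (1 + y ^ 2)⁻¹ := by
  rw [← div_eq_mul_inv, le_div_iff₀ (by positivity)]
  have h1 := Kr_le_one y
  have h2 : Kr y * y ^ 2 ≤ 4 := by
    unfold Kr
    rcases eq_or_ne y 0 with rfl | hy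
    · norm_num
    · have := Real.neg_one_le_cos y
      field_simp
      linarith
  linarith

lemma Kr_int : Integrable Kr := by
  refine (integrable_inv_one_add_sq.const_mul 5).mono' Kr_meas.aestronglyMeasurable ?_
  refine Eventually.of_forall fun y => ?_
  rw [Real.norm_of_nonneg (Kr_nonneg y)]
  exact Kr_le y

lemma Kr_integral_pos : 0 < ∫ y, Kr y := by
  rw [integral_pos_iff_support_of_nonneg Kr_nonneg Kr_int]
  refine lt_of_lt_of_le ?_ (measure_mono (s := Ioo (0:ℝ) 1) ?_)
  · simp
  · intro y hy
    have h1 : Real.cos y < 1 := by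
      have := Real.cos_lt_cos_of_nonneg_of_le_pi le_rfl (by linarith [Real.pi_gt_three, hy.2]) hy.1
      simpa using this
    have h2 : 0 < y := hy.1
    rw [Function.mem_support]
    unfold Kr
    have : 0 < 1 - Real.cos y := by linarith
    positivity

lemma Kr_fourier (y : ℝ) (hy : y ≠ 0) :
    ∫ t in (-1:ℝ)..1, ((1 - |t| : ℝ) : ℂ) * Complex.exp (Complex.I * (t * y : ℝ)) = (Kr y : ℂ) := by
  have hyc : (y : ℂ) ≠ 0 := by exact_mod_cast hy
  have hc : Continuous fun t : ℝ =>
      ((1 - |t| : ℝ) : ℂ) * Complex.exp (Complex.I * (t * y : ℝ)) := by fun_prop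
  rw [← intervalIntegral.integral_add_adjacent_intervals (b := 0)
    (hc.intervalIntegrable _ _) (hc.intervalIntegrable _ _)]
  have hd : ∀ (σ : ℂ) (t : ℝ), HasDerivAt (fun t : ℝ => (1 - σ * t) * Complex.exp (Complex.I * (t * y))
      / (Complex.I * y) - σ * Complex.exp (Complex.I * (t * y)) / y ^ 2)
      ((1 - σ * t) * Complex.exp (Complex.I * (t * y))) t := by
    intro σ t
    have h1 : HasDerivAt (fun t : ℝ => (t : ℂ)) 1 t := Complex.ofRealCLM.hasDerivAt
    have h2 : HasDerivAt (fun t : ℝ => Complex.exp (Complex.I * (t * y)))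
        (Complex.exp (Complex.I * (t * y)) * (Complex.I * (1 * y))) t :=
      ((h1.mul_const (y:ℂ)).const_mul Complex.I).cexp
    have h3 : HasDerivAt (fun t : ℝ => (1 - σ * t)) (-(σ * 1)) t := (h1.const_mul σ).const_sub 1
    have h4 := ((h3.mul h2).div_const (Complex.I * y)).sub ((h2.const_mul σ).div_const ((y:ℂ)^2))
    refine h4.congr_deriv ?_
    field_simp
    ring_nf
    simp
    try ring
  have e1 : ∫ t in (-1:ℝ)..0, ((1 - |t| : ℝ) : ℂ) * Complex.exp (Complex.I * (t * y : ℝ))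
      = ∫ t in (-1:ℝ)..0, (1 - (-1) * (t:ℂ)) * Complex.exp (Complex.I * (t * y)) := by
    refine intervalIntegral.integral_congr fun t ht => ?_
    rw [uIcc_of_le (by norm_num)] at ht
    simp [abs_of_nonpos ht.2]
  have e2 : ∫ t in (0:ℝ)..1, ((1 - |t| : ℝ) : ℂ) * Complex.exp (Complex.I * (t * y : ℝ))
      = ∫ t in (0:ℝ)..1, (1 - 1 * (t:ℂ)) * Complex.exp (Complex.I * (t * y)) := by
    refine intervalIntegral.integral_congr fun t ht => ?_
    rw [uIcc_of_le (by norm_num)] at ht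
    simp [abs_of_nonneg ht.1]
  rw [e1, e2, intervalIntegral.integral_eq_sub_of_hasDerivAt (fun t _ => hd (-1) t)
    (Continuous.intervalIntegrable (by fun_prop) _ _),
    intervalIntegral.integral_eq_sub_of_hasDerivAt (fun t _ => hd 1 t)
    (Continuous.intervalIntegrable (by fun_prop) _ _)]
  unfold Kr
  have hcos : (Real.cos y : ℂ) = (Complex.exp (Complex.I * y) + Complex.exp (-(Complex.I * y))) / 2 := by
    rw [Complex.ofReal_cos, Complex.cos]
    ring_nf
  push_cast at hcos ⊢
  rw [hcos]
  simp
  field_simp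
  ring

lemma wi_step1 (a : ℝ → ℝ) (C : ℝ) (H : ℂ → ℂ)
    (ham : Measurable a)
    (hab : ∀ ε : ℝ, 0 < ε → IntegrableOn (fun u => (a u - C) * Real.exp (-ε * u)) (Ioi 0))
    (hL : ∀ z : ℂ, 0 < z.re → ∫ u in Ioi (0:ℝ), ((a u - C : ℝ) : ℂ) * Complex.exp (-z * u) = H z)
    (ε l T : ℝ) (hε : 0 < ε) (hl : 0 < l) :
    ((∫ u in Ioi (0:ℝ), (a u - C) * Real.exp (-ε * u) * Kr (l * (u - T)) : ℝ) : ℂ) =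
      ∫ t in Ioc (-1:ℝ) 1, ((1 - |t| : ℝ) : ℂ) * Complex.exp (-(Complex.I * (t * (l * T)))) *
        H (ε - Complex.I * (l * t)) := by
  let f : ℝ → ℝ → ℂ := fun u t => (((a u - C) * Real.exp (-ε * u) : ℝ) : ℂ) *
    (((1 - |t| : ℝ) : ℂ) * Complex.exp (Complex.I * (t * (l * (u - T)) : ℝ)))
  have hprodInt : Integrable (Function.uncurry f)
      ((volume.restrict (Ioi (0:ℝ))).prod (volume.restrict (Ioc (-1:ℝ) 1))) := by
    have h1 : Integrable (fun t : ℝ => (1 - |t| : ℝ)) (volume.restrict (Ioc (-1:ℝ) 1)) :=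
      (Continuous.integrableOn_Ioc (by fun_prop))
    refine ((hab ε hε).mul_prod h1).mono ?_ ?_
    · apply Measurable.aestronglyMeasurable
      simp only [f, Function.uncurry_def]
      fun_prop
    · refine Eventually.of_forall fun p => ?_
      simp only [f, Function.uncurry_def, norm_mul, Complex.norm_real]
      rw [mul_comm Complex.I, Complex.norm_exp_ofReal_mul_I]
      simp
  have hswap := integral_integral_swap hprodInt
  have hl1 : ∫ u in Ioi (0:ℝ), ∫ t in Ioc (-1:ℝ) 1, f u t =
      ((∫ u in Ioi (0:ℝ), (a u - C) * Real.exp (-ε * u) * Kr (l * (u - T)) : ℝ) : ℂ) := by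
    rw [← integral_complex_ofReal]
    refine integral_congr_ae ?_
    have hne : ∀ᵐ u : ℝ ∂(volume.restrict (Ioi (0:ℝ))), u ≠ T :=
      ae_restrict_of_ae (by simp [ae_iff])
    filter_upwards [hne] with u hu
    simp only [f]
    rw [integral_const_mul, ← intervalIntegral.integral_of_le (by norm_num),
      Kr_fourier _ (mul_ne_zero hl.ne' (sub_ne_zero.2 hu))]
    push_cast
    rfl
  rw [← hl1, hswap]
  congr 1
  ext t
  rw [← hL _ (by simpa using hε), ← integral_const_mul]
  congr 1
  ext u
  simp only [f]
  push_cast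
  have : Complex.exp (-(ε - Complex.I * (l * t)) * u) * Complex.exp (-(Complex.I * (t * (l * T)))) =
     Complex.exp (-ε * u) * Complex.exp (Complex.I * (t * (l * (u - T)))) := by
    rw [← Complex.exp_add, ← Complex.exp_add]
    ring_nf
  linear_combination (-((a u : ℂ) - C) * (1 - ((|t| : ℝ) : ℂ))) * this

lemma wi_step2 (H : ℂ → ℂ) (hH : ContinuousOn H {z | 0 ≤ z.re}) (l T : ℝ)
    (e : ℕ → ℝ) (he0 : ∀ n, 0 < e n) (he : Tendsto e atTop (𝓝 0)) (he1 : ∀ n, e n ≤ 1) :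
    Tendsto (fun n => ∫ t in Ioc (-1:ℝ) 1, ((1 - |t| : ℝ) : ℂ) *
      Complex.exp (-(Complex.I * (t * (l * T)))) * H (e n - Complex.I * (l * t))) atTop
      (𝓝 (∫ t in Ioc (-1:ℝ) 1, ((1 - |t| : ℝ) : ℂ) *
        Complex.exp (-(Complex.I * (t * (l * T)))) * H ((0:ℝ) - Complex.I * (l * t)))) := by
  let q : ℝ × ℝ → ℂ := fun p => ((1 - |p.2| : ℝ) : ℂ) *
      Complex.exp (-(Complex.I * (p.2 * (l * T)))) * H (p.1 - Complex.I * (l * p.2))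
  have hq : ContinuousOn q (Icc 0 1 ×ˢ Icc (-1) 1) := by
    refine ContinuousOn.mul (Continuous.continuousOn (by fun_prop)) ?_
    refine hH.comp (Continuous.continuousOn (by fun_prop)) ?_
    intro p hp
    simpa using hp.1.1
  obtain ⟨M, hM⟩ := (isCompact_Icc.prod isCompact_Icc).exists_bound_of_continuousOn hq
  have hsec : ∀ s ∈ Icc (0:ℝ) 1, ContinuousOn (fun t => q (s, t)) (Icc (-1) 1) := fun s hs =>
    hq.comp (by fun_prop) (fun t ht => ⟨hs, ht⟩)
  refine tendsto_integral_of_dominated_convergence (fun _ => M) ?_ (integrable_const _) ?_ ?_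
  · intro n
    exact ((hsec (e n) ⟨(he0 n).le, he1 n⟩).mono Ioc_subset_Icc_self).aestronglyMeasurable
      measurableSet_Ioc
  · intro n
    filter_upwards [ae_restrict_mem measurableSet_Ioc] with t ht
    exact hM (e n, t) ⟨⟨(he0 n).le, he1 n⟩, Ioc_subset_Icc_self ht⟩
  · filter_upwards [ae_restrict_mem measurableSet_Ioc] with t ht
    have h1 := hq (0, t) ⟨⟨le_rfl, zero_le_one⟩, Ioc_subset_Icc_self ht⟩
    refine h1.tendsto.comp (f := fun n => (e n, t)) ?_
    refine tendsto_nhdsWithin_iff.2 ⟨?_, Eventually.of_forall fun n =>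
      ⟨⟨(he0 n).le, he1 n⟩, Ioc_subset_Icc_self ht⟩⟩
    exact he.prodMk_nhds tendsto_const_nhds

lemma Kr_comp_int (l T : ℝ) (hl : 0 < l) : Integrable (fun u => Kr (l * (u - T))) :=
  (Kr_int.comp_mul_left' hl.ne').comp_sub_right T

lemma Kr_comp_integral (l T : ℝ) (hl : 0 < l) : ∫ u, Kr (l * (u - T)) = l⁻¹ * ∫ y, Kr y := by
  rw [integral_sub_right_eq_self (fun u => Kr (l * u)) T, Measure.integral_comp_mul_left,
    abs_of_pos (inv_pos.2 hl), smul_eq_mul]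

lemma wi_step3 (a : ℝ → ℝ) (C : ℝ) (H : ℂ → ℂ) (ha0 : ∀ u, 0 ≤ a u)
    (ham : Measurable a)
    (hab : ∀ ε : ℝ, 0 < ε → IntegrableOn (fun u => (a u - C) * Real.exp (-ε * u)) (Ioi 0))
    (hH : ContinuousOn H {z | 0 ≤ z.re})
    (hL : ∀ z : ℂ, 0 < z.re → ∫ u in Ioi (0:ℝ), ((a u - C : ℝ) : ℂ) * Complex.exp (-z * u) = H z)
    (l T : ℝ) (hl : 0 < l) :
    IntegrableOn (fun u => a u * Kr (l * (u - T))) (Ioi 0) ∧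
    ((∫ u in Ioi (0:ℝ), (a u - C) * Kr (l * (u - T)) : ℝ) : ℂ) =
      ∫ t in Ioc (-1:ℝ) 1, ((1 - |t| : ℝ) : ℂ) * Complex.exp (-(Complex.I * (t * (l * T)))) *
        H ((0:ℝ) - Complex.I * (l * t)) := by
  let e : ℕ → ℝ := fun n => 1 / ((n:ℝ) + 1)
  have he0 : ∀ n, 0 < e n := fun n => by positivity
  have he1 : ∀ n, e n ≤ 1 := fun n => by
    simp only [e]
    rw [div_le_one (by positivity)]
    linarith [(Nat.cast_nonneg n : (0:ℝ) ≤ n)]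
  have he : Tendsto e atTop (𝓝 0) := tendsto_one_div_add_atTop_nhds_zero_nat
  have hlim := wi_step2 H hH l T e he0 he he1
  simp_rw [← wi_step1 a C H ham hab hL _ l T (he0 _) hl] at hlim
  have hKm : Measurable fun u => Kr (l * (u - T)) := Kr_meas.comp (by fun_prop)
  have hK := (Kr_comp_int l T hl).integrableOn (s := Ioi (0:ℝ))
  -- integrability of the damped pieces
  have hd : ∀ n, IntegrableOn (fun u => (a u - C) * Real.exp (-e n * u) * Kr (l * (u - T))) (Ioi 0) := by
    intro n
    refine Integrable.mono (hab _ (he0 n)) (by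
      apply Measurable.aestronglyMeasurable; fun_prop) ?_
    refine Eventually.of_forall fun u => ?_
    rw [norm_mul]
    refine mul_le_of_le_one_right (norm_nonneg _) ?_
    rw [Real.norm_of_nonneg (Kr_nonneg _)]
    exact Kr_le_one _
  have hexp : ∀ n, ∀ u ∈ Ioi (0:ℝ), Real.exp (-e n * u) ≤ 1 := by
    intro n u hu
    rw [Real.exp_le_one_iff]
    have := mul_pos (he0 n) hu
    linarith
  have hdC : ∀ n, IntegrableOn (fun u => C * Real.exp (-e n * u) * Kr (l * (u - T))) (Ioi 0) := by
    intro n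
    refine Integrable.mono (hK.const_mul C) (by
      apply Measurable.aestronglyMeasurable; fun_prop) ?_
    filter_upwards [ae_restrict_mem measurableSet_Ioi] with u hu
    rw [norm_mul, norm_mul, norm_mul]
    refine mul_le_mul_of_nonneg_right ?_ (norm_nonneg _)
    refine mul_le_of_le_one_right (norm_nonneg _) ?_
    rw [Real.norm_of_nonneg (Real.exp_nonneg _)]
    exact hexp n u hu
  have hdA : ∀ n, IntegrableOn (fun u => a u * Real.exp (-e n * u) * Kr (l * (u - T))) (Ioi 0) := by
    intro n
    refine ((hd n).add (hdC n)).congr (Eventually.of_forall fun u => ?_)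
    simp only [Pi.add_apply]
    ring
  have hptw : ∀ u, Tendsto (fun n => Real.exp (-e n * u)) atTop (𝓝 1) := by
    intro u
    have := ((he.neg).mul_const u).rexp
    simpa using this
  -- bound on the integrals
  have hbd : ∃ B : ℝ, ∀ n, ∫ u in Ioi (0:ℝ), a u * Real.exp (-e n * u) * Kr (l * (u - T)) ≤ B := by
    obtain ⟨M, hM⟩ := hlim.norm.bddAbove_range
    refine ⟨M + ∫ u in Ioi (0:ℝ), |C| * Kr (l * (u - T)), fun n => ?_⟩
    have h1 : ∫ u in Ioi (0:ℝ), a u * Real.exp (-e n * u) * Kr (l * (u - T)) =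
        (∫ u in Ioi (0:ℝ), (a u - C) * Real.exp (-e n * u) * Kr (l * (u - T))) +
        ∫ u in Ioi (0:ℝ), C * Real.exp (-e n * u) * Kr (l * (u - T)) := by
      rw [← integral_add (hd n) (hdC n)]
      congr 1; ext u; ring
    rw [h1]
    refine add_le_add ?_ ?_
    · have := hM ⟨n, rfl⟩
      simp only [Complex.norm_real] at this
      exact (le_abs_self _).trans this
    · refine setIntegral_mono_on (hdC n) (hK.const_mul _) measurableSet_Ioi fun u hu => ?_
      refine mul_le_mul_of_nonneg_right ?_ (Kr_nonneg _)
      calc C * Real.exp (-e n * u) ≤ |C| * Real.exp (-e n * u) := by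
            gcongr; exact le_abs_self _
        _ ≤ |C| := mul_le_of_le_one_right (abs_nonneg _) (hexp n u hu)
  have hA : IntegrableOn (fun u => a u * Kr (l * (u - T))) (Ioi 0) := by
    obtain ⟨B, hB⟩ := hbd
    refine integrable_of_tendsto (G := fun n u => a u * Real.exp (-e n * u) * Kr (l * (u - T)))
      (Eventually.of_forall fun u => ?_) (fun n => (hdA n).aestronglyMeasurable) ?_
    · have := ((hptw u).const_mul (a u)).mul_const (Kr (l * (u - T)))
      simpa using this
    · refine ne_top_of_le_ne_top (ENNReal.ofReal_ne_top (r := B)) ?_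
      refine liminf_le_of_le (by isBoundedDefault) fun b hb => ?_
      obtain ⟨n, hn⟩ := hb.exists
      refine hn.trans ?_
      rw [← ofReal_integral_norm_eq_lintegral_enorm (hdA n)]
      refine ENNReal.ofReal_le_ofReal ((le_of_eq ?_).trans (hB n))
      congr 1; ext u
      rw [Real.norm_of_nonneg]
      have := ha0 u
      have := Kr_nonneg (l * (u - T))
      positivity
  refine ⟨hA, ?_⟩
  refine tendsto_nhds_unique ?_ hlim
  refine (Complex.continuous_ofReal.tendsto _).comp ?_
  refine tendsto_integral_of_dominated_convergence
    (fun u => ‖(a u - C) * Kr (l * (u - T))‖) (fun n => (hd n).aestronglyMeasurable) ?_ ?_ ?_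
  · refine Integrable.norm ?_
    refine (hA.sub (hK.const_mul C)).congr (Eventually.of_forall fun u => ?_)
    simp only [Pi.sub_apply]
    ring
  · intro n
    filter_upwards [ae_restrict_mem measurableSet_Ioi] with u hu
    rw [norm_mul, norm_mul, norm_mul]
    refine mul_le_mul_of_nonneg_right ?_ (norm_nonneg _)
    refine mul_le_of_le_one_right (norm_nonneg _) ?_
    rw [Real.norm_of_nonneg (Real.exp_nonneg _)]
    exact hexp n u hu
  · refine Eventually.of_forall fun u => ?_
    have := ((hptw u).const_mul (a u - C)).mul_const (Kr (l * (u - T)))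
    simpa using this

lemma wi_step4 (H : ℂ → ℂ) (l : ℝ) (hl : 0 < l) :
    Tendsto (fun T : ℝ => ∫ t in Ioc (-1:ℝ) 1, ((1 - |t| : ℝ) : ℂ) *
      Complex.exp (-(Complex.I * (t * (l * T)))) * H ((0:ℝ) - Complex.I * (l * t))) atTop (𝓝 0) := by
  have h1 := Real.tendsto_integral_exp_smul_cocompact
    ((Ioc (-1:ℝ) 1).indicator fun t : ℝ => ((1 - |t| : ℝ) : ℂ) * H ((0:ℝ) - Complex.I * (l * t)))
  have h2 : Tendsto (fun T : ℝ => l / (2 * Real.pi) * T) atTop (cocompact ℝ) :=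
    (tendsto_id.const_mul_atTop (by positivity)).mono_right atTop_le_cocompact
  refine (h1.comp h2).congr fun T => ?_
  rw [← integral_indicator measurableSet_Ioc]
  simp only [Function.comp]
  congr 1; ext t
  by_cases ht : t ∈ Ioc (-1:ℝ) 1
  · rw [indicator_of_mem ht, indicator_of_mem ht, Circle.smul_def, Real.fourierChar_apply, smul_eq_mul]
    have : ((2 * Real.pi * -(t * (l / (2 * Real.pi) * T)) : ℝ) : ℂ) * Complex.I =
       -(Complex.I * (t * (l * T))) := by
      have h3 : (2 * Real.pi * -(t * (l / (2 * Real.pi) * T)) : ℝ) = -(t * (l * T)) := by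
        field_simp
      rw [h3]; push_cast; ring
    rw [this]; ring
  · rw [indicator_of_notMem ht, indicator_of_notMem ht, smul_zero]

lemma Kr_half (l : ℝ) (hl : 0 < l) :
    Tendsto (fun T : ℝ => ∫ u in Ioi (0:ℝ), Kr (l * (u - T))) atTop (𝓝 (l⁻¹ * ∫ y, Kr y)) := by
  have h1 : ∀ T : ℝ, ∫ u in Ioi (0:ℝ), Kr (l * (u - T)) =
      ∫ u, (Ioi (-T)).indicator (fun u => Kr (l * u)) u := by
    intro T
    rw [← integral_indicator measurableSet_Ioi, ← integral_add_right_eq_self _ T]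
    congr 1; ext u
    simp only [indicator, mem_Ioi, add_sub_cancel_right]
    congr 1
    simp [neg_lt_iff_pos_add]
  have h2 := Kr_comp_integral l 0 hl
  simp only [sub_zero] at h2
  rw [← h2]
  simp_rw [h1]
  have hi := Kr_int.comp_mul_left' hl.ne'
  refine tendsto_integral_filter_of_dominated_convergence (fun u => ‖Kr (l * u)‖) ?_ ?_ hi.norm ?_
  · exact Eventually.of_forall fun T => (hi.indicator measurableSet_Ioi).aestronglyMeasurable
  · exact Eventually.of_forall fun T => Eventually.of_forall fun u => norm_indicator_le_norm_self _ _
  · refine Eventually.of_forall fun u => ?_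
    refine tendsto_const_nhds.congr' ?_
    filter_upwards [eventually_gt_atTop (-u)] with T hT
    rw [indicator_of_mem]
    simp only [mem_Ioi]; linarith

lemma wi_J (a : ℝ → ℝ) (C : ℝ) (H : ℂ → ℂ) (ha0 : ∀ u, 0 ≤ a u)
    (ham : Measurable a)
    (hab : ∀ ε : ℝ, 0 < ε → IntegrableOn (fun u => (a u - C) * Real.exp (-ε * u)) (Ioi 0))
    (hH : ContinuousOn H {z | 0 ≤ z.re})
    (hL : ∀ z : ℂ, 0 < z.re → ∫ u in Ioi (0:ℝ), ((a u - C : ℝ) : ℂ) * Complex.exp (-z * u) = H z)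
    (l : ℝ) (hl : 0 < l) :
    Tendsto (fun T : ℝ => l * ∫ u in Ioi (0:ℝ), a u * Kr (l * (u - T))) atTop
      (𝓝 (C * ∫ y, Kr y)) := by
  have h1 : Tendsto (fun T : ℝ => ∫ u in Ioi (0:ℝ), (a u - C) * Kr (l * (u - T))) atTop (𝓝 0) := by
    have := wi_step4 H l hl
    simp_rw [← (wi_step3 a C H ha0 ham hab hH hL l _ hl).2] at this
    have h2 := (Complex.continuous_re.tendsto _).comp this
    simpa [Function.comp_def] using h2
  have h3 := (h1.add ((Kr_half l hl).const_mul C)).const_mul l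
  have e1 : l * (0 + C * (l⁻¹ * ∫ y, Kr y)) = C * ∫ y, Kr y := by field_simp; ring
  rw [e1] at h3
  refine h3.congr fun T => ?_
  have hA := (wi_step3 a C H ha0 ham hab hH hL l T hl).1
  have hK := (Kr_comp_int l T hl).integrableOn (s := Ioi (0:ℝ))
  have e2 : ∫ u in Ioi (0:ℝ), (a u - C) * Kr (l * (u - T)) =
      (∫ u in Ioi (0:ℝ), a u * Kr (l * (u - T))) - C * ∫ u in Ioi (0:ℝ), Kr (l * (u - T)) := by
    rw [← integral_const_mul, ← integral_sub hA (hK.const_mul C)]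
    congr 1; ext u; ring
  rw [e2]; ring

lemma Kr_window (l T δ : ℝ) (hl : 0 < l) (hδ : 0 < δ) :
    ∫ u in Ioc (T - δ) (T + δ), Kr (l * (u - T)) = l⁻¹ * ∫ y in (-(l * δ))..(l * δ), Kr y := by
  rw [← intervalIntegral.integral_of_le (by linarith)]
  have := intervalIntegral.integral_comp_mul_sub (a := T - δ) (b := T + δ) Kr hl.ne' (l * T)
  simp_rw [← mul_sub] at this
  rw [this, smul_eq_mul]
  congr 2 <;> ring

lemma wi_upper (a : ℝ → ℝ) (v : ℝ) (hv : 0 < v) (ha0 : ∀ u, 0 ≤ a u)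
    (slow : ∀ u w, u ≤ w → a u ≤ a w * Real.exp (v * (w - u)))
    (l T δ : ℝ) (hl : 0 < l) (hδ : 0 < δ) (hT : δ < T)
    (hA : IntegrableOn (fun u => a u * Kr (l * (u - T))) (Ioi 0)) :
    a (T - δ) * (∫ y in (-(l * δ))..(l * δ), Kr y) ≤
      Real.exp (2 * v * δ) * (l * ∫ u in Ioi (0:ℝ), a u * Kr (l * (u - T))) := by
  have hsub : Ioc (T - δ) (T + δ) ⊆ Ioi 0 := fun u hu => by
    have := hu.1
    simp only [mem_Ioi]; linarith
  have h1 : ∫ u in Ioc (T - δ) (T + δ), a u * Kr (l * (u - T)) ≤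
      ∫ u in Ioi (0:ℝ), a u * Kr (l * (u - T)) :=
    setIntegral_mono_set hA (Eventually.of_forall fun u => mul_nonneg (ha0 _) (Kr_nonneg _))
      hsub.eventuallyLE
  have hK := (Kr_comp_int l T hl).integrableOn (s := Ioc (T - δ) (T + δ))
  have h2 : ∫ u in Ioc (T - δ) (T + δ), a (T - δ) * Kr (l * (u - T)) ≤
      ∫ u in Ioc (T - δ) (T + δ), Real.exp (2 * v * δ) * (a u * Kr (l * (u - T))) := by
    refine setIntegral_mono_on (hK.const_mul _) ((hA.mono_set hsub).const_mul _)
      measurableSet_Ioc fun u hu => ?_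
    rw [← mul_assoc]
    refine mul_le_mul_of_nonneg_right ?_ (Kr_nonneg _)
    refine (slow (T - δ) u hu.1.le).trans ?_
    rw [mul_comm]
    refine mul_le_mul_of_nonneg_right ?_ (ha0 _)
    rw [Real.exp_le_exp]
    have := hu.2
    nlinarith
  rw [integral_const_mul, integral_const_mul, Kr_window l T δ hl hδ] at h2
  have h3 := mul_le_mul_of_nonneg_left h1 (Real.exp_pos (2 * v * δ)).le
  have h4 := mul_le_mul_of_nonneg_left (h2.trans h3) hl.le
  calc _ = l * (a (T - δ) * (l⁻¹ * ∫ y in (-(l * δ))..(l * δ), Kr y)) := by field_simp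
    _ ≤ _ := h4
    _ = _ := by ring

lemma wi_lower (a : ℝ → ℝ) (v : ℝ) (hv : 0 < v) (ha0 : ∀ u, 0 ≤ a u)
    (slow : ∀ u w, u ≤ w → a u ≤ a w * Real.exp (v * (w - u)))
    (B : ℝ) (hB : ∀ u, 0 < u → a u ≤ B)
    (l T δ : ℝ) (hl : 0 < l) (hδ : 0 < δ)
    (hA : IntegrableOn (fun u => a u * Kr (l * (u - T))) (Ioi 0)) :
    l * (∫ u in Ioi (0:ℝ), a u * Kr (l * (u - T))) ≤
      a (T + δ) * Real.exp (2 * v * δ) * (∫ y, Kr y) +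
       B * ((∫ y, Kr y) - ∫ y in (-(l * δ))..(l * δ), Kr y) := by
  have hB0 : 0 ≤ B := (ha0 1).trans (hB 1 one_pos)
  have hK := Kr_comp_int l T hl
  set D := a (T + δ) * Real.exp (2 * v * δ) with hD
  have hD0 : 0 ≤ D := mul_nonneg (ha0 _) (Real.exp_pos _).le
  have hind := hK.indicator (measurableSet_Ioc (a := T - δ) (b := T + δ))
  let g : ℝ → ℝ := fun u => D * Kr (l * (u - T)) + B * (Kr (l * (u - T)) -
    (Ioc (T - δ) (T + δ)).indicator (fun u => Kr (l * (u - T))) u)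
  have hg : Integrable g := (hK.const_mul D).add ((hK.sub hind).const_mul B)
  have hg0 : ∀ u, 0 ≤ g u := by
    intro u
    have h1 := Kr_nonneg (l * (u - T))
    have h2 : (Ioc (T - δ) (T + δ)).indicator (fun u => Kr (l * (u - T))) u ≤ Kr (l * (u - T)) :=
      indicator_le_self' (fun _ _ => h1) u
    have h3 := mul_nonneg hB0 (sub_nonneg.2 h2)
    have h4 := mul_nonneg hD0 h1
    exact add_nonneg h4 h3
  have h1 : ∫ u in Ioi (0:ℝ), a u * Kr (l * (u - T)) ≤ ∫ u in Ioi (0:ℝ), g u := by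
    refine setIntegral_mono_on hA hg.integrableOn measurableSet_Ioi fun u hu => ?_
    have h1 := Kr_nonneg (l * (u - T))
    by_cases hm : u ∈ Ioc (T - δ) (T + δ)
    · simp only [g, indicator_of_mem hm, sub_self, mul_zero, add_zero]
      refine mul_le_mul_of_nonneg_right ?_ h1
      refine (slow u (T + δ) hm.2).trans ?_
      refine mul_le_mul_of_nonneg_left ?_ (ha0 _)
      rw [Real.exp_le_exp]
      have := hm.1
      nlinarith
    · simp only [g, indicator_of_notMem hm, sub_zero]
      have := mul_le_mul_of_nonneg_right (hB u hu) h1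
      have := mul_nonneg hD0 h1
      linarith
  have h2 : ∫ u in Ioi (0:ℝ), g u ≤ ∫ u, g u :=
    setIntegral_le_integral hg (Eventually.of_forall hg0)
  have h3 : ∫ u, g u = D * (l⁻¹ * ∫ y, Kr y) + B * ((l⁻¹ * ∫ y, Kr y) -
      l⁻¹ * ∫ y in (-(l * δ))..(l * δ), Kr y) := by
    have e1 : ∫ u, g u = (∫ u, D * Kr (l * (u - T))) + ∫ u, B * (Kr (l * (u - T)) -
        (Ioc (T - δ) (T + δ)).indicator (fun u => Kr (l * (u - T))) u) :=
      integral_add (hK.const_mul D) ((hK.sub hind).const_mul B)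
    rw [e1, integral_const_mul, integral_const_mul, integral_sub hK hind,
      integral_indicator measurableSet_Ioc, Kr_window l T δ hl hδ, Kr_comp_integral l T hl]
  calc _ ≤ l * ∫ u, g u := mul_le_mul_of_nonneg_left (h1.trans h2) hl.le
    _ = _ := by rw [h3]; field_simp

lemma wi_main (a : ℝ → ℝ) (v C : ℝ) (hv : 0 < v) (H : ℂ → ℂ) (ha0 : ∀ u, 0 ≤ a u)
    (ham : Measurable a)
    (slow : ∀ u w, u ≤ w → a u ≤ a w * Real.exp (v * (w - u)))
    (hab : ∀ ε : ℝ, 0 < ε → IntegrableOn (fun u => (a u - C) * Real.exp (-ε * u)) (Ioi 0))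
    (hH : ContinuousOn H {z | 0 ≤ z.re})
    (hL : ∀ z : ℂ, 0 < z.re → ∫ u in Ioi (0:ℝ), ((a u - C : ℝ) : ℂ) * Complex.exp (-z * u) = H z) :
    Tendsto a atTop (𝓝 C) := by
  set I := ∫ y, Kr y with hI
  have hIpos : 0 < I := Kr_integral_pos
  let W : ℕ → ℝ := fun n => ∫ y in (-(n:ℝ))..(n:ℝ), Kr y
  have hW : Tendsto W atTop (𝓝 I) :=
    intervalIntegral_tendsto_integral Kr_int
      (tendsto_neg_atTop_atBot.comp tendsto_natCast_atTop_atTop) tendsto_natCast_atTop_atTop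
  have hE : Tendsto (fun n : ℕ => Real.exp (2 * v * (1 / (n:ℝ)))) atTop (𝓝 1) := by
    have := (tendsto_one_div_atTop_nhds_zero_nat (𝕜 := ℝ)).const_mul (2 * v)
    simpa using this.rexp
  have hsc : ∀ n : ℕ, 0 < n → ((n:ℝ) ^ 2) * (1 / (n:ℝ)) = n := by
    intro n hn
    have : (n:ℝ) ≠ 0 := by positivity
    field_simp
  have hJ := wi_J a C H ha0 ham hab hH hL
  have hAint := fun l T hl => (wi_step3 a C H ha0 ham hab hH hL l T hl).1
  have upper : ∀ η, C < η → ∀ᶠ T in atTop, a T < η := by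
    intro η hη
    have h1 : Tendsto (fun n => η * W n - Real.exp (2 * v * (1 / (n:ℝ))) * (C * I)) atTop
        (𝓝 (η * I - 1 * (C * I))) := (hW.const_mul η).sub (hE.mul_const _)
    have h2 : 0 < η * I - 1 * (C * I) := by nlinarith
    obtain ⟨n, ⟨hn, hWn⟩, hn0⟩ := (((h1.eventually (lt_mem_nhds h2)).and
      (hW.eventually (lt_mem_nhds hIpos))).and (eventually_gt_atTop 0)).exists
    have hnp : (0:ℝ) < n := by exact_mod_cast hn0
    have hδ : (0:ℝ) < 1 / n := by positivity
    have h3 := ((hJ ((n:ℝ)^2) (by positivity)).const_mul (Real.exp (2 * v * (1 / (n:ℝ)))))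
    have h4 := h3.eventually (gt_mem_nhds (show _ < η * W n by linarith))
    have h5 : ∀ᶠ T : ℝ in atTop, a (T - 1 / n) < η := by
      filter_upwards [h4, eventually_gt_atTop (1 / (n:ℝ))] with T hT hT2
      have h6 := wi_upper a v hv ha0 slow ((n:ℝ)^2) T (1 / n) (by positivity) hδ hT2
        (hAint _ _ (by positivity))
      rw [hsc n hn0] at h6
      exact lt_of_mul_lt_mul_right (h6.trans_lt hT) hWn.le
    have h7 := (tendsto_atTop_add_const_right atTop (1 / (n:ℝ)) tendsto_id).eventually h5
    simpa using h7
  obtain ⟨B, hB⟩ : ∃ B, ∀ u, 0 < u → a u ≤ B := by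
    obtain ⟨T0, hT0⟩ := eventually_atTop.1 (upper (C + 1) (by linarith))
    refine ⟨max (C + 1) (a T0 * Real.exp (v * T0)), fun u hu => ?_⟩
    rcases le_total T0 u with h | h
    · exact (hT0 u h).le.trans (le_max_left _ _)
    · refine (slow u T0 h).trans (le_trans ?_ (le_max_right _ _))
      refine mul_le_mul_of_nonneg_left ?_ (ha0 _)
      rw [Real.exp_le_exp]
      nlinarith
  have lower : ∀ η, η < C → ∀ᶠ T in atTop, η < a T := by
    intro η hη
    have h1 : Tendsto (fun n => C * I - B * (I - W n) - η * (Real.exp (2 * v * (1 / (n:ℝ))) * I)) atTop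
        (𝓝 (C * I - B * (I - I) - η * (1 * I))) :=
      (((hW.const_sub I).const_mul B).const_sub _).sub ((hE.mul_const _).const_mul _)
    have h2 : 0 < C * I - B * (I - I) - η * (1 * I) := by nlinarith
    obtain ⟨n, hn, hn0⟩ := ((h1.eventually (lt_mem_nhds h2)).and (eventually_gt_atTop 0)).exists
    have hnp : (0:ℝ) < n := by exact_mod_cast hn0
    have hδ : (0:ℝ) < 1 / n := by positivity
    have h4 := (hJ ((n:ℝ)^2) (by positivity)).eventually (lt_mem_nhds
      (show B * (I - W n) + η * (Real.exp (2 * v * (1 / (n:ℝ))) * I) < _ by linarith))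
    have h5 : ∀ᶠ T : ℝ in atTop, η < a (T + 1 / n) := by
      filter_upwards [h4] with T hT
      have h6 := wi_lower a v hv ha0 slow B hB ((n:ℝ)^2) T (1 / n) (by positivity) hδ
        (hAint _ _ (by positivity))
      rw [hsc n hn0] at h6
      have h8 : η * (Real.exp (2 * v * (1 / (n:ℝ))) * I) <
          a (T + 1 / n) * (Real.exp (2 * v * (1 / (n:ℝ))) * I) := by
        have h9 : W n = ∫ y in (-(n:ℝ))..(n:ℝ), Kr y := rfl
        rw [← h9, ← hI] at h6
        linarith
      exact lt_of_mul_lt_mul_right h8 (by positivity)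
    have h7 := (tendsto_atTop_add_const_right atTop (-(1 / (n:ℝ))) tendsto_id).eventually h5
    simpa using h7
  exact tendsto_order.2 ⟨lower, upper⟩

lemma laplace_count {Γ : Type*} (dfun : Γ → ℝ) (h0 : ∀ x : Γ, 0 ≤ dfun x)
    (hfin : ∀ T : ℝ, {x : Γ | dfun x < T}.Finite) (s : ℂ) (hs : 0 < s.re) (g : ℂ)
    (hsum : HasSum (fun x : Γ => Complex.exp (-s * (dfun x : ℂ))) g) :
    ∫ u in Ioi (0:ℝ), (({x : Γ | dfun x < u}.ncard : ℝ) : ℂ) * Complex.exp (-s * u) = g / s := by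
  have hcount : Countable Γ := by
    rw [← Set.countable_univ_iff]
    have : (univ : Set Γ) = ⋃ n : ℕ, {x : Γ | dfun x < n} := by
      ext x
      simpa using exists_nat_gt (dfun x)
    rw [this]
    exact countable_iUnion fun n => (hfin n).countable
  have hs0 : s ≠ 0 := by rintro rfl; simp at hs
  let F : Γ → ℝ → ℂ := fun x => (Ioi (dfun x)).indicator fun u => Complex.exp (-s * u)
  have hinter : ∀ x, Ioi (dfun x) ∩ Ioi (0:ℝ) = Ioi (dfun x) := fun x =>
    inter_eq_left.2 (Ioi_subset_Ioi (h0 x))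
  have hre : (-s).re < 0 := by simpa using hs
  have hFi : ∀ x, Integrable (F x) (volume.restrict (Ioi 0)) := by
    intro x
    refine Integrable.indicator ?_ measurableSet_Ioi
    exact integrableOn_exp_mul_complex_Ioi hre 0
  have hFint : ∀ x, ∫ u in Ioi (0:ℝ), F x u = Complex.exp (-s * dfun x) / s := by
    intro x
    simp only [F]
    rw [integral_indicator measurableSet_Ioi, Measure.restrict_restrict measurableSet_Ioi, hinter,
      integral_exp_mul_complex_Ioi hre]
    field_simp
  have hFn : ∀ x, ∫ u in Ioi (0:ℝ), ‖F x u‖ = ‖Complex.exp (-s * dfun x)‖ / s.re := by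
    intro x
    have : ∀ u, ‖F x u‖ = (Ioi (dfun x)).indicator (fun u => Real.exp (-s.re * u)) u := by
      intro u
      simp only [F]
      rw [norm_indicator_eq_indicator_norm]
      congr 1; ext u
      rw [Complex.norm_exp]; simp
    simp_rw [this]
    rw [integral_indicator measurableSet_Ioi, Measure.restrict_restrict measurableSet_Ioi, hinter,
      integral_exp_mul_Ioi (by linarith), Complex.norm_exp]
    simp [neg_div_neg_eq]
  have hns : Summable fun x => ∫ u in Ioi (0:ℝ), ‖F x u‖ := by
    simp_rw [hFn]
    exact hsum.summable.norm.div_const _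
  have h1 := hasSum_integral_of_summable_integral_norm hFi hns
  simp_rw [hFint] at h1
  have h2 := h1.unique (hsum.div_const s)
  rw [← h2]
  congr 1; ext u
  rw [tsum_eq_sum (s := (hfin u).toFinset)]
  · rw [Finset.sum_congr rfl (g := fun _ => Complex.exp (-s * u))]
    · rw [Finset.sum_const, nsmul_eq_mul, Set.ncard_eq_toFinset_card _ (hfin u)]
      simp
    · intro x hx
      have : dfun x < u := by simpa using hx
      exact indicator_of_mem (by simpa using this) _
  · intro x hx
    have : ¬ dfun x < u := by simpa using hx
    exact indicator_of_notMem (by simpa using this) _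

lemma count_bound {Γ : Type*} (dfun : Γ → ℝ)
    (hfin : ∀ T : ℝ, {x : Γ | dfun x < T}.Finite) (σ : ℝ) (hσ : 0 < σ)
    (hsum : Summable (fun x : Γ => Real.exp (-σ * dfun x))) (u : ℝ) :
    ({x : Γ | dfun x < u}.ncard : ℝ) * Real.exp (-σ * u) ≤ ∑' x, Real.exp (-σ * dfun x) := by
  refine le_trans ?_ (hsum.sum_le_tsum (hfin u).toFinset fun _ _ => (Real.exp_pos _).le)
  rw [Set.ncard_eq_toFinset_card _ (hfin u), ← nsmul_eq_mul]
  refine Finset.card_nsmul_le_sum _ _ _ fun x hx => ?_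
  have : dfun x < u := by simpa using hx
  rw [Real.exp_le_exp]
  nlinarith

/-- Wiener–Ikehara: if the Poincaré series η(s) = Σ e^{-s d(o,x)} with abscissa of
convergence v > 0 extends analytically to Re(s) ≥ v except for a simple pole of
positive residue at s = v, then #{x : d(o,x) < T} ∼ C e^{vT}. -/
theorem stmt16 {Γ : Type*} (dfun : Γ → ℝ) (h0 : ∀ x : Γ, 0 ≤ dfun x)
    (hfin : ∀ T : ℝ, {x : Γ | dfun x < T}.Finite)
    (v : ℝ) (hv : 0 < v)
    (habs : v = sInf {s : ℝ | Summable (fun x : Γ => Real.exp (-s * dfun x))})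
    (hext : ∃ (U : Set ℂ) (G : ℂ → ℂ) (c : ℝ), 0 < c ∧ IsOpen U ∧
      {s : ℂ | v ≤ s.re} ⊆ U ∧
      (∀ s : ℂ, v < s.re →
        HasSum (fun x : Γ => Complex.exp (-s * (dfun x : ℂ))) (G s)) ∧
      (∀ s ∈ U, s ≠ (v : ℂ) → AnalyticAt ℂ G s) ∧
      AnalyticAt ℂ (fun s : ℂ => G s - (c : ℂ) / (s - (v : ℂ))) (v : ℂ)) :
    ∃ C : ℝ, 0 < C ∧
      Filter.Tendsto
        (fun T : ℝ => ({x : Γ | dfun x < T}.ncard : ℝ) / (C * Real.exp (v * T)))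
        Filter.atTop (nhds 1) := by
  obtain ⟨U, G, c, hc, -, hU, hsum, hG, hpole⟩ := hext
  have hC : 0 < c / v := div_pos hc hv
  refine ⟨c / v, hC, ?_⟩
  set C := c / v with hCdef
  let N : ℝ → ℝ := fun u => ({x : Γ | dfun x < u}.ncard : ℝ)
  have hN0 : ∀ u, 0 ≤ N u := fun u => Nat.cast_nonneg _
  have hNmono : Monotone N := fun u w h => by
    refine Nat.cast_le.2 (Set.ncard_le_ncard (fun x hx => ?_) (hfin w))
    exact lt_of_lt_of_le hx h
  let a : ℝ → ℝ := fun u => N u * Real.exp (-v * u)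
  have ham : Measurable a := hNmono.measurable.mul (by fun_prop)
  have hrs : ∀ σ : ℝ, v < σ → Summable (fun x : Γ => Real.exp (-σ * dfun x)) := by
    intro σ hσ
    have := (hsum σ (by simpa using hσ)).summable.norm
    refine this.congr fun x => ?_
    rw [Complex.norm_exp]; simp
  have hexpi : ∀ ε : ℝ, 0 < ε → IntegrableOn (fun u => Real.exp (-ε * u)) (Ioi 0) :=
    fun ε hε => exp_neg_integrableOn_Ioi 0 hε
  have haint : ∀ ε : ℝ, 0 < ε → IntegrableOn (fun u => a u * Real.exp (-ε * u)) (Ioi 0) := by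
    intro ε hε
    refine Integrable.mono' ((hexpi (ε / 2) (by positivity)).const_mul
      (∑' x, Real.exp (-(v + ε / 2) * dfun x))) (by
        apply Measurable.aestronglyMeasurable; fun_prop) ?_
    refine Eventually.of_forall fun u => ?_
    have h1 := count_bound dfun hfin (v + ε / 2) (by positivity) (hrs _ (by linarith)) u
    rw [Real.norm_of_nonneg (by have := hN0 u; positivity)]
    have h2 := mul_le_mul_of_nonneg_right h1 (Real.exp_pos (-(ε / 2) * u)).le
    refine le_trans (le_of_eq ?_) h2
    simp only [a, N]
    rw [mul_assoc, mul_assoc, ← Real.exp_add, ← Real.exp_add]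
    ring_nf
  have hab : ∀ ε : ℝ, 0 < ε → IntegrableOn (fun u => (a u - C) * Real.exp (-ε * u)) (Ioi 0) := by
    intro ε hε
    refine ((haint ε hε).sub ((hexpi ε hε).const_mul C)).congr (Eventually.of_forall fun u => ?_)
    simp only [Pi.sub_apply]
    ring
  have hvc : (v : ℂ) ≠ 0 := by exact_mod_cast hv.ne'
  let F : ℂ → ℂ := fun s => G s - (c : ℂ) / (s - (v : ℂ))
  have hF : ∀ s : ℂ, v ≤ s.re → ContinuousAt F s := by
    intro s hs
    by_cases h : s = v
    · rw [h]; exact hpole.continuousAt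
    · have h1 := (hG s (hU hs) h).continuousAt
      refine h1.sub (continuousAt_const.div (by fun_prop) (sub_ne_zero.2 h))
  let H : ℂ → ℂ := fun z => F (v + z) / (v + z) - C / (v + z)
  have hvz : ∀ z : ℂ, 0 ≤ z.re → (v : ℂ) + z ≠ 0 := by
    intro z hz h
    have := congrArg Complex.re h
    simp at this
    linarith
  have hH : ContinuousOn H {z | 0 ≤ z.re} := by
    intro z hz
    refine ContinuousAt.continuousWithinAt ?_
    have h1 : ContinuousAt (fun z : ℂ => (v:ℂ) + z) z := by fun_prop
    have h2 : ContinuousAt (fun z : ℂ => F (v + z)) z :=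
      ContinuousAt.comp (f := fun z : ℂ => (v:ℂ) + z) (g := F)
        (hF _ (by simpa using hz)) h1
    exact (h2.div h1 (hvz z hz)).sub (continuousAt_const.div h1 (hvz z hz))
  have hL : ∀ z : ℂ, 0 < z.re →
      ∫ u in Ioi (0:ℝ), ((a u - C : ℝ) : ℂ) * Complex.exp (-z * u) = H z := by
    intro z hz
    have hz0 : z ≠ 0 := by rintro rfl; simp at hz
    have hs := hsum (v + z) (by simpa using hz)
    have h1 := laplace_count dfun h0 hfin (v + z) (by simp; linarith) _ hs
    have h2 : ∫ u in Ioi (0:ℝ), Complex.exp (-z * u) = 1 / z := by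
      rw [integral_exp_mul_complex_Ioi (by simpa using hz)]
      simp
    have hi1 : Integrable (fun u : ℝ => (a u : ℂ) * Complex.exp (-z * u))
        (volume.restrict (Ioi 0)) := by
      refine Integrable.mono (haint z.re hz) (by
        apply Measurable.aestronglyMeasurable; fun_prop) ?_
      refine Eventually.of_forall fun u => ?_
      rw [norm_mul, norm_mul, Complex.norm_real, Complex.norm_exp, Real.norm_of_nonneg (Real.exp_pos _).le]
      simp
    have hi2 : Integrable (fun u : ℝ => (C : ℂ) * Complex.exp (-z * u))
        (volume.restrict (Ioi 0)) :=
      (integrableOn_exp_mul_complex_Ioi (a := -z) (by simpa using hz) 0).const_mul _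
    have h3 : ∫ u in Ioi (0:ℝ), ((a u - C : ℝ) : ℂ) * Complex.exp (-z * u) =
        (∫ u in Ioi (0:ℝ), (a u : ℂ) * Complex.exp (-z * u)) -
          ∫ u in Ioi (0:ℝ), (C : ℂ) * Complex.exp (-z * u) := by
      rw [← integral_sub hi1 hi2]
      congr 1; ext u
      push_cast; ring
    have h4 : ∫ u in Ioi (0:ℝ), (a u : ℂ) * Complex.exp (-z * u) = G (v + z) / (v + z) := by
      rw [← h1]
      congr 1; ext u
      simp only [a, N]
      push_cast
      rw [mul_assoc, ← Complex.exp_add]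
      ring_nf
    rw [h3, h4, integral_const_mul, h2]
    simp only [H, F, hCdef]
    have := hvz z hz.le
    push_cast
    rw [add_sub_cancel_left]
    field_simp
    ring
  have ha0 : ∀ u, 0 ≤ a u := fun u => mul_nonneg (hN0 u) (Real.exp_pos _).le
  have slow : ∀ u w, u ≤ w → a u ≤ a w * Real.exp (v * (w - u)) := by
    intro u w h
    simp only [a]
    rw [mul_assoc, ← Real.exp_add]
    have e : -v * w + v * (w - u) = -v * u := by ring
    rw [e]
    exact mul_le_mul_of_nonneg_right (hNmono h) (Real.exp_pos _).le
  have hmain := (wi_main a v C hv H ha0 ham slow hab hH hL).div_const C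
  rw [div_self hC.ne'] at hmain
  refine hmain.congr fun T => ?_
  simp only [a, N]
  rw [neg_mul, Real.exp_neg]
  have := Real.exp_pos (v * T)
  field_simp
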